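/- (Theorem 3, sufficiency.) Assume every cell serves at least one UE and d_j > 0 for every UE j. If ρ* ∈ ℝ^n_{≥0} satisfies f(ρ*) = ρ* and ρ*_i ≤ ρ̄ for all i, then ρ* is feasible and ρ* ≤ ρ componentwise for every feasible load vector ρ; consequently, for every function F : ℝ^n → ℝ that is monotonically increasing (ρ ≤ ρ' componentwise implies F(ρ) ≤ F(ρ')), ρ* minimizes F over all feasible load vectors, i.e., ρ* is globally optimal for problem MinF. -/

import Mathlib

open Finset
open scoped Classical

/-- Multi-cell NOMA load-coupling model: `n` cells, a finite set `J` of UEs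
(each served by exactly one cell), and a finite index type `C` of candidate UE clusters. -/
structure NomaModel (n : ℕ) (J C : Type) [Fintype J] [Fintype C] where
  /-- the serving cell of each UE -/
  serving : J → Fin n
  /-- the cell that each cluster belongs to -/
  cell : C → Fin n
  /-- the UEs forming each cluster -/
  members : C → Finset J
  /-- channel gain from cell `k` to UE `j` -/
  g : Fin n → J → ℝ
  /-- per-RB transmit power of each cell -/
  p : Fin n → ℝ
  /-- intra-cluster power split: power allocated to UE `j` within cluster `u` -/
  psplit : C → J → ℝ
  /-- decoding order on each cluster -/
  b : C → J → ℕ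
  /-- noise power -/
  σsq : ℝ
  /-- number of RBs -/
  M : ℝ
  /-- per-RB bandwidth -/
  B : ℝ
  /-- UE demands -/
  d : J → ℝ
  /-- load limit -/
  ρbar : ℝ
  members_nonempty : ∀ u, (members u).Nonempty
  members_served : ∀ u, ∀ j ∈ members u, serving j = cell u
  covers : ∀ j, ∃ u, j ∈ members u
  g_pos : ∀ k j, 0 < g k j
  p_pos : ∀ k, 0 < p k
  psplit_pos : ∀ u, ∀ j ∈ members u, 0 < psplit u j
  psplit_sum : ∀ u, ∑ j ∈ members u, psplit u j = p (cell u)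
  b_injOn : ∀ u, Set.InjOn (b u) (members u)
  σsq_pos : 0 < σsq
  M_pos : 0 < M
  B_pos : 0 < B
  d_nonneg : ∀ j, 0 ≤ d j
  ρbar_pos : 0 < ρbar
  ρbar_le_one : ρbar ≤ 1

namespace NomaModel

variable {n : ℕ} {J C : Type} [Fintype J] [Fintype C]

/-- SINR of UE `j` in cluster `u` under load vector `ρ` (eq. (1) with averaged
inter-cell interference (2)). -/
noncomputable def sinr (mdl : NomaModel n J C) (ρ : Fin n → ℝ) (u : C) (j : J) : ℝ :=
  mdl.psplit u j * mdl.g (mdl.cell u) j /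
    ((∑ h ∈ (mdl.members u).filter (fun h => mdl.b u h < mdl.b u j),
        mdl.psplit u h * mdl.g (mdl.cell u) j)
      + (∑ k ∈ Finset.univ.filter (fun k => k ≠ mdl.cell u), mdl.p k * mdl.g k j * ρ k)
      + mdl.σsq)

/-- Total capacity over all RBs for UE `j` in cluster `u` (eq. (3)). -/
noncomputable def cap (mdl : NomaModel n J C) (ρ : Fin n → ℝ) (u : C) (j : J) : ℝ :=
  mdl.M * mdl.B * Real.log (1 + mdl.sinr ρ u j)

/-- A load vector `ρ` is feasible if `0 ≤ ρ_i ≤ ρ̄` for every cell and some nonnegative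
resource allocation `x` over clusters realizes the loads and meets all UE demands
(eqs. (1)–(5)). -/
noncomputable def Feasible (mdl : NomaModel n J C) (ρ : Fin n → ℝ) : Prop :=
  (∀ i, 0 ≤ ρ i ∧ ρ i ≤ mdl.ρbar) ∧
  ∃ x : C → ℝ, (∀ u, 0 ≤ x u) ∧
    (∀ i, ρ i = ∑ u ∈ Finset.univ.filter (fun u => mdl.cell u = i), x u) ∧
    (∀ j, mdl.d j ≤ ∑ u ∈ Finset.univ.filter (fun u => j ∈ mdl.members u),
      mdl.cap ρ u j * x u)

/-- Per-cell minimum-load function `f_i(ρ)` (eqs. (7)/(8)): the minimum load of cell `i`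
needed to serve the demands of its UEs, given the other cells' loads `ρ`. -/
noncomputable def f (mdl : NomaModel n J C) (ρ : Fin n → ℝ) (i : Fin n) : ℝ :=
  sInf { s : ℝ | ∃ x : C → ℝ, (∀ u, 0 ≤ x u) ∧
    (∀ j, mdl.serving j = i →
      mdl.d j ≤ ∑ u ∈ Finset.univ.filter (fun u => mdl.cell u = i ∧ j ∈ mdl.members u),
        mdl.cap ρ u j * x u) ∧
    s = ∑ u ∈ Finset.univ.filter (fun u => mdl.cell u = i), x u }

end NomaModel


namespace NomaModel

section aux
variable {n : ℕ} {J C : Type} [Fintype J] [Fintype C]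

/-- interference-plus-noise denominator -/
noncomputable def denAux (mdl : NomaModel n J C) (ρ : Fin n → ℝ) (u : C) (j : J) : ℝ :=
  (∑ h ∈ (mdl.members u).filter (fun h => mdl.b u h < mdl.b u j),
        mdl.psplit u h * mdl.g (mdl.cell u) j)
      + (∑ k ∈ Finset.univ.filter (fun k => k ≠ mdl.cell u), mdl.p k * mdl.g k j * ρ k)
      + mdl.σsq

lemma sinr_eq_aux (mdl : NomaModel n J C) (ρ : Fin n → ℝ) (u : C) (j : J) :
    mdl.sinr ρ u j = mdl.psplit u j * mdl.g (mdl.cell u) j / mdl.denAux ρ u j := rfl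

lemma intra_nonneg_aux (mdl : NomaModel n J C) (u : C) (j : J) :
    0 ≤ ∑ h ∈ (mdl.members u).filter (fun h => mdl.b u h < mdl.b u j),
        mdl.psplit u h * mdl.g (mdl.cell u) j := by
  apply Finset.sum_nonneg
  intro h hh
  exact (mul_pos (mdl.psplit_pos u h (Finset.mem_filter.1 hh).1) (mdl.g_pos _ _)).le

lemma denAux_pos (mdl : NomaModel n J C) {ρ : Fin n → ℝ} (hρ : ∀ i, 0 ≤ ρ i) (u : C) (j : J) :
    0 < mdl.denAux ρ u j := by
  have h1 := mdl.intra_nonneg_aux u j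
  have h2 : 0 ≤ ∑ k ∈ Finset.univ.filter (fun k => k ≠ mdl.cell u),
      mdl.p k * mdl.g k j * ρ k :=
    Finset.sum_nonneg fun k _ =>
      mul_nonneg (mul_pos (mdl.p_pos k) (mdl.g_pos k j)).le (hρ k)
  have h3 := mdl.σsq_pos
  unfold denAux
  linarith

lemma sinr_pos_aux (mdl : NomaModel n J C) {ρ : Fin n → ℝ} (hρ : ∀ i, 0 ≤ ρ i) {u : C} {j : J}
    (hj : j ∈ mdl.members u) : 0 < mdl.sinr ρ u j := by
  rw [sinr_eq_aux]
  exact div_pos (mul_pos (mdl.psplit_pos u j hj) (mdl.g_pos _ _)) (mdl.denAux_pos hρ u j)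

lemma cap_pos_aux (mdl : NomaModel n J C) {ρ : Fin n → ℝ} (hρ : ∀ i, 0 ≤ ρ i) {u : C} {j : J}
    (hj : j ∈ mdl.members u) : 0 < mdl.cap ρ u j := by
  have := mdl.sinr_pos_aux hρ hj
  exact mul_pos (mul_pos mdl.M_pos mdl.B_pos) (Real.log_pos (by linarith))

lemma cap_scale_aux (mdl : NomaModel n J C) {ρ ρ' : Fin n → ℝ} (hρ : ∀ i, 0 ≤ ρ i)
    (hρ' : ∀ i, 0 ≤ ρ' i) {α : ℝ} (hα : 1 < α) (hle : ∀ i, ρ' i ≤ α * ρ i) {u : C} {j : J}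
    (hj : j ∈ mdl.members u) : mdl.cap ρ u j < α * mdl.cap ρ' u j := by
  have hD := mdl.denAux_pos hρ u j
  have hD' := mdl.denAux_pos hρ' u j
  have ha : 0 < mdl.psplit u j * mdl.g (mdl.cell u) j :=
    mul_pos (mdl.psplit_pos u j hj) (mdl.g_pos _ _)
  have hlt : mdl.denAux ρ' u j < α * mdl.denAux ρ u j := by
    have h1 := mdl.intra_nonneg_aux u j
    have h2 : ∑ k ∈ Finset.univ.filter (fun k => k ≠ mdl.cell u), mdl.p k * mdl.g k j * ρ' k ≤
        α * ∑ k ∈ Finset.univ.filter (fun k => k ≠ mdl.cell u), mdl.p k * mdl.g k j * ρ k := by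
      rw [Finset.mul_sum]
      apply Finset.sum_le_sum
      intro k _
      have := mul_le_mul_of_nonneg_left (hle k) (mul_pos (mdl.p_pos k) (mdl.g_pos k j)).le
      linarith
    have h3 := mdl.σsq_pos
    unfold denAux
    nlinarith
  have hs' := mdl.sinr_pos_aux hρ' hj
  have hs := mdl.sinr_pos_aux hρ hj
  have hy : mdl.sinr ρ u j < α * mdl.sinr ρ' u j := by
    rw [sinr_eq_aux, sinr_eq_aux, ← mul_div_assoc, div_lt_div_iff₀ hD hD']
    nlinarith
  have hb := one_add_mul_self_le_rpow_one_add (s := mdl.sinr ρ' u j) (by linarith) hα.le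
  have hl : Real.log (1 + mdl.sinr ρ u j) < α * Real.log (1 + mdl.sinr ρ' u j) := by
    rw [← Real.log_rpow (by linarith)]
    exact Real.log_lt_log (by linarith) (by linarith)
  have := mul_lt_mul_of_pos_left hl (mul_pos mdl.M_pos mdl.B_pos)
  unfold cap
  linarith

/-- The linear program defining `f_i` attains its minimum. -/
lemma f_attained_aux (mdl : NomaModel n J C) {ρ : Fin n → ℝ} (hρ : ∀ i, 0 ≤ ρ i) (i : Fin n) :
    ∃ x : C → ℝ, (∀ u, 0 ≤ x u) ∧
    (∀ j, mdl.serving j = i →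
      mdl.d j ≤ ∑ u ∈ Finset.univ.filter (fun u => mdl.cell u = i ∧ j ∈ mdl.members u),
        mdl.cap ρ u j * x u) ∧
    mdl.f ρ i = ∑ u ∈ Finset.univ.filter (fun u => mdl.cell u = i), x u := by
  -- the feasible allocations
  let P : (C → ℝ) → Prop := fun x => (∀ u, 0 ≤ x u) ∧
    (∀ j, mdl.serving j = i →
      mdl.d j ≤ ∑ u ∈ Finset.univ.filter (fun u => mdl.cell u = i ∧ j ∈ mdl.members u),
        mdl.cap ρ u j * x u)
  let S : (C → ℝ) → ℝ := fun x => ∑ u ∈ Finset.univ.filter (fun u => mdl.cell u = i), x u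
  let tr : (C → ℝ) → (C → ℝ) := fun x u => if mdl.cell u = i then x u else 0
  have htrP : ∀ x, P x → P (tr x) := by
    rintro x ⟨h0, h1⟩
    refine ⟨fun u => ?_, fun j hj => (h1 j hj).trans (le_of_eq ?_)⟩
    · simp only [tr]; split_ifs
      · exact h0 u
      · exact le_rfl
    · apply Finset.sum_congr rfl
      intro u hu
      simp [tr, (Finset.mem_filter.1 hu).2.1]
  have htrS : ∀ x, S (tr x) = S x := by
    intro x
    apply Finset.sum_congr rfl
    intro u hu
    simp [tr, (Finset.mem_filter.1 hu).2]
  -- a feasible point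
  obtain ⟨x0, hx0⟩ : ∃ x0, P x0 := by
    have hev : ∀ᶠ K : ℝ in Filter.atTop, 0 ≤ K ∧ ∀ j : J, ∀ u : C, j ∈ mdl.members u →
        mdl.d j ≤ mdl.cap ρ u j * K := by
      refine (Filter.eventually_ge_atTop 0).and ?_
      rw [Filter.eventually_all]; intro j
      rw [Filter.eventually_all]; intro u
      by_cases hj : j ∈ mdl.members u
      · filter_upwards [Filter.eventually_ge_atTop (mdl.d j / mdl.cap ρ u j)] with K hK _
        rw [div_le_iff₀ (mdl.cap_pos_aux hρ hj)] at hK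
        linarith
      · exact Filter.Eventually.of_forall fun K h => absurd h hj
    obtain ⟨K, hK0, hK⟩ := hev.exists
    refine ⟨fun _ => K, fun _ => hK0, fun j hj => ?_⟩
    obtain ⟨u, hu⟩ := mdl.covers j
    refine (hK j u hu).trans ?_
    apply Finset.single_le_sum (f := fun u => mdl.cap ρ u j * K)
    · intro v hv
      exact mul_nonneg (mdl.cap_pos_aux hρ (Finset.mem_filter.1 hv).2.2).le hK0
    · simp only [Finset.mem_filter, Finset.mem_univ, true_and]
      exact ⟨by rw [← mdl.members_served u j hu, hj], hu⟩
  have hScont : Continuous S := by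
    simp only [S]; fun_prop
  have hPclosed : IsClosed {x | P x} := by
    have h1 : IsClosed {x : C → ℝ | ∀ u, 0 ≤ x u} := by
      simp only [Set.ofPred_forall]
      exact isClosed_iInter fun u => isClosed_le continuous_const (continuous_apply u)
    have h2 : IsClosed {x : C → ℝ | ∀ j, mdl.serving j = i →
      mdl.d j ≤ ∑ u ∈ Finset.univ.filter (fun u => mdl.cell u = i ∧ j ∈ mdl.members u),
        mdl.cap ρ u j * x u} := by
      simp only [Set.ofPred_forall]
      exact isClosed_iInter fun j => isClosed_iInter fun _ =>
        isClosed_le continuous_const (by fun_prop)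
    exact h1.inter h2
  let T : Set (C → ℝ) := {x | P x} ∩ Set.Icc 0 (fun _ => S x0)
  have hT : IsCompact T := isCompact_Icc.inter_left hPclosed
  have hbd : ∀ x, P x → S x ≤ S x0 → tr x ∈ T := by
    intro x hx hS
    refine ⟨htrP x hx, fun u => (htrP x hx).1 u, fun u => ?_⟩
    have hS0 : 0 ≤ S x0 := Finset.sum_nonneg fun u _ => hx0.1 u
    simp only [tr]
    split_ifs with hu
    · refine le_trans ?_ hS
      exact Finset.single_le_sum (f := x) (fun v _ => hx.1 v) (by simp [hu])
    · exact hS0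
  obtain ⟨x, hxT, hmin⟩ := hT.exists_isMinOn ⟨_, hbd x0 hx0 le_rfl⟩ hScont.continuousOn
  have hx0min : S x ≤ S x0 := by
    have := hmin (hbd x0 hx0 le_rfl)
    simpa [htrS] using this
  refine ⟨x, hxT.1.1, hxT.1.2, ?_⟩
  have hleast : IsLeast { s : ℝ | ∃ x : C → ℝ, (∀ u, 0 ≤ x u) ∧
    (∀ j, mdl.serving j = i →
      mdl.d j ≤ ∑ u ∈ Finset.univ.filter (fun u => mdl.cell u = i ∧ j ∈ mdl.members u),
        mdl.cap ρ u j * x u) ∧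
    s = ∑ u ∈ Finset.univ.filter (fun u => mdl.cell u = i), x u } (S x) := by
    refine ⟨⟨x, hxT.1.1, hxT.1.2, rfl⟩, ?_⟩
    rintro s ⟨y, hy0, hy1, rfl⟩
    change S x ≤ S y
    by_cases h : S y ≤ S x0
    · have := hmin (hbd y ⟨hy0, hy1⟩ h)
      simpa [htrS] using this
    · linarith
  exact hleast.csInf_eq

lemma filter_members_aux (mdl : NomaModel n J C) {i : Fin n} {j : J} (hj : mdl.serving j = i) :
    Finset.univ.filter (fun u => mdl.cell u = i ∧ j ∈ mdl.members u) =
      Finset.univ.filter (fun u => j ∈ mdl.members u) := by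
  ext u
  simp only [Finset.mem_filter, Finset.mem_univ, true_and, and_iff_right_iff_imp]
  intro hu
  rw [← mdl.members_served u j hu, hj]

lemma f_le_aux (mdl : NomaModel n J C) {ρ : Fin n → ℝ} {i : Fin n} {x : C → ℝ}
    (h0 : ∀ u, 0 ≤ x u)
    (h1 : ∀ j, mdl.serving j = i →
      mdl.d j ≤ ∑ u ∈ Finset.univ.filter (fun u => j ∈ mdl.members u), mdl.cap ρ u j * x u) :
    mdl.f ρ i ≤ ∑ u ∈ Finset.univ.filter (fun u => mdl.cell u = i), x u := by
  refine csInf_le ⟨0, ?_⟩ ⟨x, h0, fun j hj => ?_, rfl⟩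
  · rintro s ⟨y, hy, -, rfl⟩
    exact Finset.sum_nonneg fun u _ => hy u
  · rw [mdl.filter_members_aux hj]
    exact h1 j hj

lemma fixed_le_aux (mdl : NomaModel n J C)
    (hserve : ∀ i : Fin n, ∃ j : J, mdl.serving j = i)
    (hd : ∀ j, 0 < mdl.d j)
    (ρstar : Fin n → ℝ) (hρ0 : ∀ i, 0 ≤ ρstar i)
    (hfix : mdl.f ρstar = ρstar) (ρ : Fin n → ℝ) (hρ : mdl.Feasible ρ) (i₀ : Fin n) :
    ρstar i₀ ≤ ρ i₀ := by
  obtain ⟨hb, x, hx0, hxs, hxd⟩ := hρ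
  have hnn : ∀ i, 0 ≤ ρ i := fun i => (hb i).1
  have hpos : ∀ i, 0 < ρ i := by
    intro i
    refine lt_of_le_of_ne (hnn i) fun h0 => ?_
    obtain ⟨j, hj⟩ := hserve i
    have hz : ∀ u ∈ Finset.univ.filter (fun u => mdl.cell u = i), x u = 0 :=
      (Finset.sum_eq_zero_iff_of_nonneg fun u _ => hx0 u).1 ((hxs i).symm.trans h0.symm)
    have h2 := hxd j
    rw [← mdl.filter_members_aux hj, Finset.sum_eq_zero] at h2
    · exact absurd (hd j) (not_lt.2 h2)
    · intro u hu
      rw [hz u (by simp [(Finset.mem_filter.1 hu).2.1]), mul_zero]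
  obtain ⟨i, -, hi⟩ := Finset.exists_max_image Finset.univ (fun i => ρstar i / ρ i)
    ⟨i₀, Finset.mem_univ _⟩
  by_contra hcon
  set α := ρstar i / ρ i with hαdef
  have hα : 1 < α :=
    lt_of_lt_of_le ((one_lt_div (hpos i₀)).2 (not_le.1 hcon)) (hi i₀ (Finset.mem_univ _))
  have hle : ∀ k, ρstar k ≤ α * ρ k := fun k =>
    (div_le_iff₀ (hpos k)).1 (hi k (Finset.mem_univ _))
  have heq : ρstar i = α * ρ i := by
    rw [hαdef, div_mul_cancel₀ _ (hpos i).ne']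
  have hev : ∀ᶠ β in nhdsWithin α (Set.Iio α), (β < α ∧ 1 < β) ∧
      ∀ j : J, ∀ u : C, j ∈ mdl.members u → mdl.cap ρ u j ≤ β * mdl.cap ρstar u j := by
    refine (Filter.Eventually.and self_mem_nhdsWithin
      (nhdsWithin_le_nhds (lt_mem_nhds hα))).and ?_
    rw [Filter.eventually_all]; intro j
    rw [Filter.eventually_all]; intro u
    by_cases hj : j ∈ mdl.members u
    · have hc := mdl.cap_scale_aux hnn hρ0 hα hle hj
      have hp := mdl.cap_pos_aux hρ0 hj
      filter_upwards [nhdsWithin_le_nhds (lt_mem_nhds ((div_lt_iff₀ hp).2 hc))] with β hβ _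
      exact ((div_lt_iff₀ hp).1 hβ).le
    · exact Filter.Eventually.of_forall fun K h => absurd h hj
  obtain ⟨β, ⟨hβα, hβ1⟩, hβ⟩ := hev.exists
  have hf := mdl.f_le_aux (ρ := ρstar) (i := i) (x := fun u => β * x u)
    (fun u => mul_nonneg (by linarith) (hx0 u)) (fun j _ => by
      refine (hxd j).trans (Finset.sum_le_sum fun u hu => ?_)
      have := mul_le_mul_of_nonneg_right (hβ j u (Finset.mem_filter.1 hu).2) (hx0 u)
      linarith)
  rw [hfix, ← Finset.mul_sum, ← hxs i, heq] at hf
  have := mul_lt_mul_of_pos_right hβα (hpos i)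
  linarith

end aux

end NomaModel

/-- Theorem 3, sufficiency: assume every cell serves at least one UE and all demands are
strictly positive. If `ρ* ≥ 0` satisfies `f(ρ*) = ρ*` and `ρ*_i ≤ ρ̄` for all `i`, then
`ρ*` is feasible, is componentwise below every feasible load vector, and hence minimizes
every monotonically increasing objective `F` over the feasible set (global optimum of
MinF). -/
theorem NomaModel.fixedPoint_optimal {n : ℕ} {J C : Type} [Fintype J] [Fintype C]
    (mdl : NomaModel n J C)
    (hserve : ∀ i : Fin n, ∃ j : J, mdl.serving j = i)
    (hd : ∀ j, 0 < mdl.d j)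
    (ρstar : Fin n → ℝ) (hρ0 : ∀ i, 0 ≤ ρstar i)
    (hfix : mdl.f ρstar = ρstar) (hbar : ∀ i, ρstar i ≤ mdl.ρbar) :
    mdl.Feasible ρstar ∧
      (∀ ρ : Fin n → ℝ, mdl.Feasible ρ → ∀ i, ρstar i ≤ ρ i) ∧
      (∀ F : (Fin n → ℝ) → ℝ,
        (∀ ρ ρ' : Fin n → ℝ, (∀ i, ρ i ≤ ρ' i) → F ρ ≤ F ρ') →
        ∀ ρ : Fin n → ℝ, mdl.Feasible ρ → F ρstar ≤ F ρ) := by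
  have hmin := mdl.fixed_le_aux hserve hd ρstar hρ0 hfix
  refine ⟨⟨fun i => ⟨hρ0 i, hbar i⟩, ?_⟩, hmin, fun F hF ρ hρ => hF _ _ (hmin ρ hρ)⟩
  choose y hy0 hy1 hy2 using fun i => mdl.f_attained_aux hρ0 i
  refine ⟨fun u => y (mdl.cell u) u, fun u => hy0 _ u, fun i => ?_, fun j => ?_⟩
  · rw [← congrFun hfix i, hy2 i]
    apply Finset.sum_congr rfl
    intro u hu
    beta_reduce
    rw [(Finset.mem_filter.1 hu).2]
  · refine (hy1 _ j rfl).trans (le_of_eq ?_)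
    rw [mdl.filter_members_aux rfl]
    apply Finset.sum_congr rfl
    intro u hu
    rw [mdl.members_served u j (Finset.mem_filter.1 hu).2]
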